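/- The rank-one sum bound in the ∞-norm: Σ_{j=1}^N P_{ij} ‖y_j − ȳ‖_∞ · ‖y_i − y_j‖₁ ≤ √d · c, where ‖u‖_∞ = max_m |u_m| and ‖u‖₁ = Σ_m |u_m| for u ∈ ℝ^d. Equivalently, Σ_{j=1}^N ‖P_{ij}(y_j − ȳ)(y_i − y_j)⊤‖_∞ ≤ √d · c, where ‖·‖_∞ on matrices is the maximum absolute row sum. -/

import Mathlib

open BigOperators

/-- The function `r ↦ (r - c) exp (-r)` is maximal at `r = c + 1`. -/
lemma sub_mul_exp_neg_le (c r : ℝ) :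
    (r - c) * Real.exp (-r) ≤ Real.exp (-(c + 1)) := by
  have h := Real.add_one_le_exp (r - (c + 1))
  have h' : r - c ≤ Real.exp (r - (c + 1)) := by linarith
  calc (r - c) * Real.exp (-r) ≤ Real.exp (r - (c + 1)) * Real.exp (-r) := by gcongr
    _ = Real.exp (-(c + 1)) := by rw [← Real.exp_add]; ring_nf

/-- A Gibbs average of energies one of which vanishes is at most `c`, where
`c * exp (c + 1)` is the number of remaining energies. -/
lemma sum_exp_neg_mul_le {ι : Type*} [Fintype ι] (r : ι → ℝ) (i : ι) (hi : r i = 0)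
    (c : ℝ) (hc : c * Real.exp (c + 1) = (Fintype.card ι : ℝ) - 1) :
    ∑ j, Real.exp (-r j) * r j ≤ c * ∑ j, Real.exp (-r j) := by
  classical
  have hrest : ∑ j ∈ Finset.univ.erase i, (r j - c) * Real.exp (-r j) ≤ c := by
    calc ∑ j ∈ Finset.univ.erase i, (r j - c) * Real.exp (-r j)
        ≤ ∑ _j ∈ Finset.univ.erase i, Real.exp (-(c + 1)) :=
          Finset.sum_le_sum fun j _ => sub_mul_exp_neg_le c (r j)
      _ = ((Fintype.card ι : ℝ) - 1) * Real.exp (-(c + 1)) := by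
          rw [Finset.sum_const, nsmul_eq_mul, Finset.cast_card_erase_of_mem (Finset.mem_univ i),
            Finset.card_univ]
      _ = c := by rw [← hc, mul_assoc, ← Real.exp_add, add_neg_cancel, Real.exp_zero, mul_one]
  have hsplit := Finset.add_sum_erase Finset.univ
    (fun j => (r j - c) * Real.exp (-r j)) (Finset.mem_univ i)
  have hexpand : ∑ j, (r j - c) * Real.exp (-r j) =
      ∑ j, Real.exp (-r j) * r j - c * ∑ j, Real.exp (-r j) := by
    rw [Finset.mul_sum, ← Finset.sum_sub_distrib]
    exact Finset.sum_congr rfl fun j _ => by ring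
  simp only [hi, neg_zero, Real.exp_zero, zero_sub, mul_one] at hsplit
  linarith

/-- The weighted variance is at most the weighted second moment about any point. -/
lemma sum_mul_sub_mean_sq_le {ι : Type*} [Fintype ι] (P x : ι → ℝ) (hP : ∑ j, P j = 1) (a : ℝ) :
    ∑ j, P j * (x j - ∑ k, P k * x k) ^ 2 ≤ ∑ j, P j * (x j - a) ^ 2 := by
  set b := ∑ k, P k * x k with hb
  have h : ∑ j, P j * (x j - a) ^ 2 = ∑ j, P j * (x j - b) ^ 2 +
      (2 * (b - a) * ∑ j, P j * x j + (a ^ 2 - b ^ 2) * ∑ j, P j) := by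
    rw [Finset.mul_sum, Finset.mul_sum, ← Finset.sum_add_distrib, ← Finset.sum_add_distrib]
    exact Finset.sum_congr rfl fun j _ => by ring
  rw [← hb, hP] at h
  nlinarith [sq_nonneg (b - a)]

/-- The product of a sup norm and an `ℓ¹` norm, bounded through Euclidean norms. -/
lemma iSup_abs_mul_sum_abs_le {κ : Type*} [Fintype κ] (u v : κ → ℝ) :
    (⨆ m, |u m|) * ∑ m, |v m| ≤
      √(Fintype.card κ) * ((∑ m, u m ^ 2 + ∑ m, v m ^ 2) / 2) := by
  have hu : (⨆ m, |u m|) ≤ √(∑ m, u m ^ 2) :=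
    Real.iSup_le (fun m => Real.abs_le_sqrt
      (Finset.single_le_sum (f := fun m => u m ^ 2) (fun k _ => sq_nonneg (u k))
        (Finset.mem_univ m))) (Real.sqrt_nonneg _)
  have hv : ∑ m, |v m| ≤ √(Fintype.card κ) * √(∑ m, v m ^ 2) := by
    rw [← Real.sqrt_mul (Nat.cast_nonneg _)]
    apply Real.le_sqrt_of_sq_le
    simpa using sq_sum_le_card_mul_sum_sq (s := Finset.univ) (f := fun m => |v m|)
  have hamgm : √(∑ m, u m ^ 2) * √(∑ m, v m ^ 2) ≤ (∑ m, u m ^ 2 + ∑ m, v m ^ 2) / 2 := by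
    have h1 := Real.sq_sqrt (Finset.sum_nonneg fun m (_ : m ∈ Finset.univ) => sq_nonneg (u m))
    have h2 := Real.sq_sqrt (Finset.sum_nonneg fun m (_ : m ∈ Finset.univ) => sq_nonneg (v m))
    linarith [two_mul_le_add_sq √(∑ m, u m ^ 2) √(∑ m, v m ^ 2)]
  calc (⨆ m, |u m|) * ∑ m, |v m|
      ≤ √(∑ m, u m ^ 2) * (√(Fintype.card κ) * √(∑ m, v m ^ 2)) := by gcongr
    _ = √(Fintype.card κ) * (√(∑ m, u m ^ 2) * √(∑ m, v m ^ 2)) := by ring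
    _ ≤ _ := by gcongr

/-- The rank-one sum bound in the ∞-norm:
`∑ⱼ Pⱼ ‖yⱼ − ȳ‖_∞ ‖yᵢ − yⱼ‖₁ ≤ √d · c`, where `Pⱼ` are the softmax weights
`Pⱼ ∝ exp(−‖yⱼ − yᵢ‖₂²)`, `ȳ = ∑ₖ Pₖ yₖ`, and `c·exp(c+1) = N − 1`.
(Equivalently `∑ⱼ ‖Pⱼ(yⱼ − ȳ)(yᵢ − yⱼ)ᵀ‖_∞ ≤ √d · c` since
`‖u vᵀ‖_∞ = ‖u‖_∞ ‖v‖₁`.) -/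
theorem softmax_rank_one_sum_inf_le
    (N d : ℕ) (hN : 1 ≤ N) (hd : 1 ≤ d)
    (y : Fin N → Fin d → ℝ) (i : Fin N)
    (P : Fin N → ℝ)
    (hP : ∀ j, P j = Real.exp (-(∑ m, (y j m - y i m) ^ 2)) /
      ∑ k, Real.exp (-(∑ m, (y k m - y i m) ^ 2)))
    (ybar : Fin d → ℝ) (hybar : ∀ m, ybar m = ∑ k, P k * y k m)
    (c : ℝ) (hc0 : 0 ≤ c) (hc : c * Real.exp (c + 1) = (N : ℝ) - 1) :
    ∑ j, P j * (⨆ m, |y j m - ybar m|) * (∑ m, |y i m - y j m|) ≤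
      Real.sqrt d * c := by
  set r : Fin N → ℝ := fun j => ∑ m, (y j m - y i m) ^ 2 with hr
  have hZ : 0 < ∑ k, Real.exp (-r k) :=
    Finset.sum_pos (fun k _ => Real.exp_pos _) ⟨i, Finset.mem_univ i⟩
  have hP' : ∀ j, P j = Real.exp (-r j) / ∑ k, Real.exp (-r k) := hP
  have hP0 : ∀ j, 0 ≤ P j := fun j => by rw [hP' j]; positivity
  have hP1 : ∑ j, P j = 1 := by
    simp only [hP']
    rw [← Finset.sum_div, div_self hZ.ne']
  have hmoment : ∑ j, P j * r j ≤ c := by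
    simp only [hP', div_mul_eq_mul_div]
    rw [← Finset.sum_div, div_le_iff₀ hZ]
    exact sum_exp_neg_mul_le r i (by simp [hr]) c (by simpa using hc)
  have hvar : ∑ j, P j * ∑ m, (y j m - ybar m) ^ 2 ≤ ∑ j, P j * r j := by
    simp only [hr, Finset.mul_sum]
    rw [Finset.sum_comm, Finset.sum_comm (f := fun j m => P j * (y j m - y i m) ^ 2)]
    refine Finset.sum_le_sum fun m _ => ?_
    rw [hybar m]
    exact sum_mul_sub_mean_sq_le P (fun j => y j m) hP1 (y i m)
  have hterm : ∀ j, P j * (⨆ m, |y j m - ybar m|) * (∑ m, |y i m - y j m|) ≤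
      √d * ((P j * ∑ m, (y j m - ybar m) ^ 2 + P j * r j) / 2) := fun j => by
    have h := mul_le_mul_of_nonneg_left
      (iSup_abs_mul_sum_abs_le (fun m => y j m - ybar m) fun m => y j m - y i m) (hP0 j)
    simp only [Fintype.card_fin] at h
    simp only [abs_sub_comm (y i _)]
    calc _ = _ := mul_assoc _ _ _
      _ ≤ _ := h
      _ = _ := by simp only [hr]; ring
  calc _ ≤ ∑ j, √d * ((P j * ∑ m, (y j m - ybar m) ^ 2 + P j * r j) / 2) :=
        Finset.sum_le_sum fun j _ => hterm j
    _ = √d * ((∑ j, P j * ∑ m, (y j m - ybar m) ^ 2 + ∑ j, P j * r j) / 2) := by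
        rw [← Finset.mul_sum, ← Finset.sum_div, Finset.sum_add_distrib]
    _ ≤ √d * c := by gcongr; linarith
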